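/- For all real c > 0, the integral ∫₀^∞ η⁶(i·4x/π) · cos(cx) dx equals (π/4) · Σ_{n≥1} χ(n) · n · cosh((π/2)A(n,c)) · cos((π/2)B(n,c)) / ( cosh²((π/2)A(n,c)) − sin²((π/2)B(n,c)) ). -/

import Mathlib

open Real

/-- Dedekind eta function on the imaginary axis: `dedekindEtaI x = η(i x)`
for real `x > 0`, with `q = e^{-2πx}`. -/
noncomputable def dedekindEtaI (x : ℝ) : ℝ :=
  Real.exp (-(π * x) / 12) * ∏' n : ℕ, (1 - Real.exp (-(2 * π * x) * (n + 1)))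

noncomputable def A (b c : ℝ) : ℝ := Real.sqrt ((Real.sqrt (b ^ 4 + c ^ 2) + b ^ 2) / 2)

noncomputable def B (b c : ℝ) : ℝ := Real.sqrt ((Real.sqrt (b ^ 4 + c ^ 2) - b ^ 2) / 2)

/-- The character χ with χ(n)=0 for even n, 1 for n ≡ 1 (mod 4), −1 for n ≡ 3 (mod 4). -/
noncomputable def chi (n : ℕ) : ℝ :=
  if n % 2 = 0 then 0 else if n % 4 = 1 then 1 else -1

open Filter Topology MeasureTheory

/-- The partial product `∏_{i < n} (1 - q^{i+1})`. -/
noncomputable def partialEuler (q : ℝ) (n : ℕ) : ℝ := ∏ i ∈ Finset.range n, (1 - q ^ (i + 1))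

/-- The reciprocal of `partialEuler q n`, extended by zero to negative `n`. -/
noncomputable def recipEuler (q : ℝ) : ℤ → ℝ
  | Int.ofNat n => (partialEuler q n)⁻¹
  | Int.negSucc _ => 0

lemma partialEuler_pos {q : ℝ} (h0 : 0 ≤ q) (h1 : q < 1) (n : ℕ) : 0 < partialEuler q n :=
  Finset.prod_pos fun i _ => sub_pos.2 (pow_lt_one₀ h0 h1 i.succ_ne_zero)

lemma partialEuler_succ (q : ℝ) (n : ℕ) :
    partialEuler q (n + 1) = partialEuler q n * (1 - q ^ (n + 1)) :=
  Finset.prod_range_succ _ _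

lemma recipEuler_sub_one {q : ℝ} (h0 : 0 ≤ q) (h1 : q < 1) (n : ℤ) :
    recipEuler q (n - 1) = (1 - q ^ n) * recipEuler q n := by
  rcases n with n | n
  · rcases n with - | n
    · change recipEuler q (Int.negSucc 0) = _
      simp [recipEuler]
    · have h : Int.ofNat (n + 1) - 1 = Int.ofNat n := by simp
      have hq : (1 : ℝ) - q ^ (n + 1) ≠ 0 := (sub_pos.2 (pow_lt_one₀ h0 h1 n.succ_ne_zero)).ne'
      rw [h]
      simp only [recipEuler, partialEuler_succ, Int.ofNat_eq_natCast, zpow_natCast]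
      have := (partialEuler_pos h0 h1 n).ne'
      field_simp
  · have h : Int.negSucc n - 1 = Int.negSucc (n + 1) := by omega
    rw [h]; simp [recipEuler]

/-- The coefficients `(-1)^k r^{(2 k + 1)²} [2 N + 1 choose N - k]_q`, `q = r⁸`, of the finite form of
Jacobi's identity. -/
noncomputable def jacobiCoeff (r : ℝ) (N : ℕ) (k : ℤ) : ℝ :=
  (-1) ^ k * r ^ ((2 * k + 1) ^ 2) * partialEuler (r ^ 8) (2 * N + 1) *
    (recipEuler (r ^ 8) (N - k) * recipEuler (r ^ 8) (N + 1 + k))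

lemma jacobiCoeff_neg_one (r : ℝ) (N : ℕ) : jacobiCoeff r N (-1) = - jacobiCoeff r N 0 := by
  simp only [jacobiCoeff, sub_neg_eq_add, sub_zero, add_zero, add_neg_cancel_right]
  norm_num only [Int.reduceMul, Int.reduceAdd]
  simp
  exact Or.inl (mul_comm _ _)

lemma jacobiCoeff_eq_zero (r : ℝ) {N : ℕ} {k : ℤ} (h : N < k) : jacobiCoeff r N k = 0 := by
  obtain ⟨m, hm⟩ : ∃ m : ℕ, (N : ℤ) - k = Int.negSucc m := Int.eq_negSucc_of_lt_zero (by omega)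
  simp [jacobiCoeff, hm, recipEuler]

lemma jacobiCoeff_succ {r : ℝ} (h0 : 0 < r) (h1 : r < 1) (N : ℕ) (k : ℤ) :
    jacobiCoeff r (N + 1) k = (1 + (r ^ 8) ^ (2 * N + 2)) * jacobiCoeff r N k -
      (r ^ 8) ^ (N + 1) * (jacobiCoeff r N (k - 1) + jacobiCoeff r N (k + 1)) := by
  have hq0 : (0 : ℝ) ≤ r ^ 8 := by positivity
  have hq1 : r ^ 8 < 1 := pow_lt_one₀ h0.le h1 (by norm_num)
  have hr : r ≠ 0 := h0.ne'
  have e1 := recipEuler_sub_one hq0 hq1 (N + 1 - k)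
  have e2 := recipEuler_sub_one hq0 hq1 (N - k)
  have e3 := recipEuler_sub_one hq0 hq1 (N + 2 + k)
  have e4 := recipEuler_sub_one hq0 hq1 (N + 1 + k)
  rw [show (N : ℤ) + 1 - k - 1 = N - k by ring] at e1
  rw [show (N : ℤ) + 2 + k - 1 = N + 1 + k by ring] at e3
  have hk1 : r ^ ((2 * (k - 1) + 1) ^ 2) = r ^ ((2 * k + 1) ^ 2) * ((r ^ 8) ^ k)⁻¹ := by
    rw [← zpow_natCast, ← zpow_mul, ← zpow_neg, ← zpow_add₀ hr]
    congr 1; push_cast; ring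
  have hk2 : r ^ ((2 * (k + 1) + 1) ^ 2) = r ^ ((2 * k + 1) ^ 2) * ((r ^ 8) ^ k * r ^ 8) := by
    rw [← zpow_natCast, ← zpow_mul, ← zpow_add₀ hr, ← zpow_add₀ hr]
    congr 1; push_cast; ring
  have hp : partialEuler (r ^ 8) (2 * (N + 1) + 1) = partialEuler (r ^ 8) (2 * N + 1) *
      (1 - (r ^ 8) ^ (2 * N + 2)) * (1 - (r ^ 8) ^ (2 * N + 3)) := by
    rw [show 2 * (N + 1) + 1 = 2 * N + 1 + 1 + 1 by ring, partialEuler_succ, partialEuler_succ]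
  have hs1 : (-1 : ℝ) ^ (k - 1) = - (-1) ^ k := by rw [zpow_sub_one₀ (by norm_num)]; norm_num
  have hs2 : (-1 : ℝ) ^ (k + 1) = - (-1) ^ k := by rw [zpow_add_one₀ (by norm_num)]; norm_num
  unfold jacobiCoeff
  rw [hk1, hk2, hp, hs1, hs2]
  push_cast
  rw [show (N : ℤ) - (k - 1) = N + 1 - k by ring, show (N : ℤ) + 1 + (k - 1) = N + 1 + k - 1 by ring,
    show (N : ℤ) - (k + 1) = N - k - 1 by ring, show (N : ℤ) + 1 + (k + 1) = N + 2 + k by ring,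
    show (N : ℤ) + 1 + 1 + k = N + 2 + k by ring, e4, e2, e1, e3]
  have hq : r ^ 8 ≠ 0 := by positivity
  generalize recipEuler (r ^ 8) (N + 1 - k) = X
  generalize recipEuler (r ^ 8) (N + 2 + k) = Y
  generalize partialEuler (r ^ 8) (2 * N + 1) = Z
  generalize r ^ ((2 * k + 1) ^ 2) = W
  generalize (-1 : ℝ) ^ k = V
  generalize r ^ 8 = q at *
  have f1 : q ^ ((N : ℤ) + 1 - k) = q ^ N * q / q ^ k := by
    rw [zpow_sub₀ hq, zpow_add_one₀ hq, zpow_natCast]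
  have f2 : q ^ ((N : ℤ) - k) = q ^ N / q ^ k := by
    rw [zpow_sub₀ hq, zpow_natCast]
  have f3 : q ^ ((N : ℤ) + 2 + k) = q ^ N * q ^ 2 * q ^ k := by
    rw [zpow_add₀ hq, zpow_add₀ hq, zpow_natCast]; norm_cast
  have f4 : q ^ ((N : ℤ) + 1 + k) = q ^ N * q * q ^ k := by
    rw [zpow_add₀ hq, zpow_add_one₀ hq, zpow_natCast]
  rw [f1, f2, f3, f4]
  have hqk : q ^ k ≠ 0 := zpow_ne_zero _ hq
  generalize q ^ k = b at *
  have g1 : q ^ (2 * N + 2) = (q ^ N) ^ 2 * q ^ 2 := by ring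
  have g2 : q ^ (2 * N + 3) = (q ^ N) ^ 2 * q ^ 3 := by ring
  rw [g1, g2, pow_succ q N]
  generalize q ^ N = a
  field_simp
  ring

lemma sum_second_difference {c : ℤ → ℝ} (hc : c (-1) = - c 0) (M : ℕ) :
    ∑ k ∈ Finset.range M, (2 * (k : ℝ) + 1) * (c (k - 1) + c (k + 1) - 2 * c k) =
      (2 * M - 1) * c M - (2 * M + 1) * c (M - 1) := by
  induction M with
  | zero => simp [hc]
  | succ M ih =>
    rw [Finset.sum_range_succ, ih]
    push_cast
    rw [add_sub_cancel_right]
    ring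

lemma sum_jacobiCoeff {r : ℝ} (h0 : 0 < r) (h1 : r < 1) (N M : ℕ) (h : N < M) :
    ∑ k ∈ Finset.range M, (2 * (k : ℝ) + 1) * jacobiCoeff r N k =
      r * partialEuler (r ^ 8) N ^ 2 := by
  induction N with
  | zero =>
    rw [Finset.sum_eq_single_of_mem 0 (by simpa using h)]
    · have h8 : 1 - r ^ 8 ≠ 0 := (sub_pos.2 (pow_lt_one₀ h0.le h1 (by norm_num))).ne'
      have h : recipEuler (r ^ 8) 1 = (1 - r ^ 8)⁻¹ := by
        change (partialEuler (r ^ 8) 1)⁻¹ = _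
        simp [partialEuler]
      have h' : recipEuler (r ^ 8) 0 = 1 := by
        change (partialEuler (r ^ 8) 0)⁻¹ = _
        simp [partialEuler]
      simp [jacobiCoeff, h, h']
      simp [partialEuler, h8]
    · intro k _ hk
      rw [jacobiCoeff_eq_zero r (by exact_mod_cast Nat.pos_of_ne_zero hk), mul_zero]
  | succ N ih =>
    have hd := sum_second_difference (jacobiCoeff_neg_one r N) M
    rw [jacobiCoeff_eq_zero r (by exact_mod_cast (by omega : N < M)),
      jacobiCoeff_eq_zero r (by omega)] at hd
    have := ih (by omega)
    calc _ = (1 - (r ^ 8) ^ (N + 1)) ^ 2 *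
            ∑ k ∈ Finset.range M, (2 * (k : ℝ) + 1) * jacobiCoeff r N k -
          (r ^ 8) ^ (N + 1) * ∑ k ∈ Finset.range M, (2 * (k : ℝ) + 1) *
            (jacobiCoeff r N (k - 1) + jacobiCoeff r N (k + 1) - 2 * jacobiCoeff r N k) := by
          rw [Finset.mul_sum, Finset.mul_sum, ← Finset.sum_sub_distrib]
          refine Finset.sum_congr rfl fun k _ => ?_
          rw [jacobiCoeff_succ h0 h1]
          ring
      _ = _ := by
          rw [hd, this, partialEuler_succ]
          ring

lemma partialEuler_le_one {q : ℝ} (h0 : 0 ≤ q) (h1 : q < 1) (n : ℕ) : partialEuler q n ≤ 1 :=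
  Finset.prod_le_one (fun i _ => (sub_pos.2 (pow_lt_one₀ h0 h1 i.succ_ne_zero)).le)
    fun i _ => sub_le_self _ (by positivity)

lemma multipliable_one_sub_pow_succ {q : ℝ} (h0 : 0 ≤ q) (h1 : q < 1) :
    Multipliable fun n : ℕ => 1 - q ^ (n + 1) := by
  simp_rw [sub_eq_add_neg]
  refine multipliable_one_add_of_summable ?_
  simpa [abs_of_nonneg h0] using (summable_nat_add_iff 1).mpr (summable_geometric_of_lt_one h0 h1)

lemma tendsto_partialEuler {q : ℝ} (h0 : 0 ≤ q) (h1 : q < 1) :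
    Tendsto (partialEuler q) atTop (𝓝 (∏' n : ℕ, (1 - q ^ (n + 1)))) :=
  (multipliable_one_sub_pow_succ h0 h1).hasProd.tendsto_prod_nat

lemma tprod_one_sub_pow_pos {q : ℝ} (h0 : 0 ≤ q) (h1 : q < 1) :
    0 < ∏' n : ℕ, (1 - q ^ (n + 1)) := by
  refine lt_of_le_of_ne (ge_of_tendsto' (tendsto_partialEuler h0 h1)
    fun n => (partialEuler_pos h0 h1 n).le) (Ne.symm ?_)
  simp_rw [sub_eq_add_neg]
  refine tprod_one_add_ne_zero_of_summable (f := fun n => -q ^ (n + 1)) (fun n => ?_) ?_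
  · rw [← sub_eq_add_neg]
    exact (sub_pos.2 (pow_lt_one₀ h0 h1 n.succ_ne_zero)).ne'
  · simpa [abs_of_nonneg h0] using
      (summable_nat_add_iff 1).mpr (summable_geometric_of_lt_one h0 h1)

lemma tprod_le_partialEuler {q : ℝ} (h0 : 0 ≤ q) (h1 : q < 1) (n : ℕ) :
    ∏' n : ℕ, (1 - q ^ (n + 1)) ≤ partialEuler q n := by
  refine Antitone.le_of_tendsto (antitone_nat_of_succ_le fun n => ?_) (tendsto_partialEuler h0 h1) n
  rw [partialEuler_succ]
  exact mul_le_of_le_one_right (partialEuler_pos h0 h1 n).le (sub_le_self _ (by positivity))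

lemma recipEuler_nonneg {q : ℝ} (h0 : 0 ≤ q) (h1 : q < 1) (n : ℤ) : 0 ≤ recipEuler q n := by
  rcases n with n | n
  · exact inv_nonneg.2 (partialEuler_pos h0 h1 n).le
  · exact le_rfl

lemma recipEuler_le {q : ℝ} (h0 : 0 ≤ q) (h1 : q < 1) (n : ℤ) :
    recipEuler q n ≤ (∏' n : ℕ, (1 - q ^ (n + 1)))⁻¹ := by
  have := tprod_one_sub_pow_pos h0 h1
  rcases n with n | n
  · exact inv_anti₀ this (tprod_le_partialEuler h0 h1 n)
  · exact (inv_pos.2 this).le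

lemma tendsto_recipEuler {q : ℝ} (h0 : 0 ≤ q) (h1 : q < 1) :
    Tendsto (recipEuler q) atTop (𝓝 (∏' n : ℕ, (1 - q ^ (n + 1)))⁻¹) := by
  have h := (tendsto_partialEuler h0 h1).inv₀ (tprod_one_sub_pow_pos h0 h1).ne'
  refine (h.comp (tendsto_atTop_atTop.2 fun b => ⟨(b : ℤ), fun (a : ℤ) (ha : (b : ℤ) ≤ a) =>
    (by omega : b ≤ a.toNat)⟩)).congr' ?_
  filter_upwards [eventually_ge_atTop 0] with n hn
  lift n to ℕ using hn
  rfl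

lemma summable_odd_mul_pow_sq {r : ℝ} (h0 : 0 ≤ r) (h1 : r < 1) :
    Summable fun k : ℕ => (2 * (k : ℝ) + 1) * r ^ ((2 * k + 1) ^ 2) := by
  have h := summable_pow_mul_geometric_of_norm_lt_one 1 (r := r) (by rwa [norm_of_nonneg h0])
  have hs := (summable_nat_add_iff 1).2 (h.mul_left 2)
  refine Summable.of_nonneg_of_le (fun k => by positivity) (fun k => ?_) hs
  have : r ^ ((2 * k + 1) ^ 2) ≤ r ^ (k + 1) := pow_le_pow_of_le_one h0 h1.le (by nlinarith)
  push_cast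
  rw [pow_one, ← mul_assoc]
  exact mul_le_mul (by linarith) this (by positivity) (by positivity)

/-- The Jacobi identity for the cube of the Euler product, in the variable `r = q^{1/8}`. -/
theorem hasSum_jacobi_cube {r : ℝ} (h0 : 0 < r) (h1 : r < 1) :
    HasSum (fun k : ℕ => (-1 : ℝ) ^ k * (2 * (k : ℝ) + 1) * r ^ ((2 * k + 1) ^ 2))
      (r * (∏' n : ℕ, (1 - (r ^ 8) ^ (n + 1))) ^ 3) := by
  have hq0 : (0 : ℝ) ≤ r ^ 8 := by positivity
  have hq1 : r ^ 8 < 1 := pow_lt_one₀ h0.le h1 (by norm_num)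
  have hL := tprod_one_sub_pow_pos hq0 hq1
  have hP := tendsto_partialEuler hq0 hq1
  have hR := tendsto_recipEuler hq0 hq1
  have hRle := recipEuler_le hq0 hq1
  set L := ∏' n : ℕ, (1 - (r ^ 8) ^ (n + 1)) with hLdef
  have hsum := summable_odd_mul_pow_sq h0.le h1
  have hzpow (k : ℕ) : r ^ ((2 * (k : ℤ) + 1) ^ 2) = r ^ ((2 * k + 1) ^ 2) := by norm_cast
  have hlim : Tendsto (fun N : ℕ => ∑' k : ℕ, (2 * (k : ℝ) + 1) * jacobiCoeff r N k) atTop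
      (𝓝 (∑' k : ℕ, (-1 : ℝ) ^ k * (2 * (k : ℝ) + 1) * r ^ ((2 * k + 1) ^ 2) * L⁻¹)) := by
    refine tendsto_tsum_of_dominated_convergence (hsum.mul_right (L⁻¹ * L⁻¹)) (fun k => ?_)
      (Eventually.of_forall fun N k => ?_)
    · have a1 : Tendsto (fun N : ℕ => (N : ℤ) - k) atTop atTop :=
        tendsto_atTop_add_const_right _ (-(k : ℤ)) tendsto_natCast_atTop_atTop
      have a2 : Tendsto (fun N : ℕ => (N : ℤ) + 1 + k) atTop atTop :=
        tendsto_atTop_add_const_right _ _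
          (tendsto_atTop_add_const_right _ _ tendsto_natCast_atTop_atTop)
      have a3 : Tendsto (fun N : ℕ => 2 * N + 1) atTop atTop :=
        tendsto_atTop_mono (fun N => by simp only [id]; omega) tendsto_id
      have := (((hP.comp a3).mul ((hR.comp a1).mul (hR.comp a2)))).const_mul
        ((-1 : ℝ) ^ k * (2 * (k : ℝ) + 1) * r ^ ((2 * k + 1) ^ 2))
      rw [mul_inv_cancel_left₀ hL.ne'] at this
      refine this.congr fun N => ?_
      simp only [jacobiCoeff, hzpow, zpow_natCast, Function.comp]
      ring
    · have b1 := hRle (N - k)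
      have b2 := hRle (N + 1 + k)
      have n1 := recipEuler_nonneg hq0 hq1 (N - k)
      have n2 := recipEuler_nonneg hq0 hq1 (N + 1 + k)
      have p1 := partialEuler_le_one hq0 hq1 (2 * N + 1)
      have p0 := partialEuler_pos hq0 hq1 (2 * N + 1)
      simp only [jacobiCoeff, hzpow, zpow_natCast, norm_mul, norm_pow, norm_neg, norm_one, one_pow,
        one_mul]
      rw [norm_of_nonneg n1, norm_of_nonneg n2, norm_of_nonneg p0.le, norm_of_nonneg h0.le,
        norm_of_nonneg (by positivity : 0 ≤ 2 * (k : ℝ) + 1), mul_assoc (r ^ _), ← mul_assoc]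
      refine mul_le_mul_of_nonneg_left ?_ (by positivity)
      calc _ ≤ 1 * (L⁻¹ * L⁻¹) := by gcongr
        _ = _ := one_mul _
  have heq : (fun N : ℕ => ∑' k : ℕ, (2 * (k : ℝ) + 1) * jacobiCoeff r N k) =
      fun N => r * partialEuler (r ^ 8) N ^ 2 := by
    funext N
    rw [← sum_jacobiCoeff h0 h1 N (N + 1) N.lt_succ_self]
    refine tsum_eq_sum fun k hk => ?_
    rw [jacobiCoeff_eq_zero r (by simp at hk; omega), mul_zero]
  rw [heq, tsum_mul_right] at hlim
  have huniq := tendsto_nhds_unique hlim ((hP.pow 2).const_mul r)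
  have hs : Summable fun k : ℕ => (-1 : ℝ) ^ k * (2 * (k : ℝ) + 1) * r ^ ((2 * k + 1) ^ 2) := by
    refine Summable.of_norm (hsum.congr fun k => ?_)
    rw [mul_assoc, norm_mul, norm_pow, norm_neg, norm_one, one_pow, one_mul,
      norm_of_nonneg (by positivity)]
  convert hs.hasSum using 1
  rw [← div_eq_mul_inv, div_eq_iff hL.ne'] at huniq
  rw [huniq]
  ring
lemma cot_add_cot {a b : ℂ} (h : a + b = π / 2) :
    Complex.cot a + Complex.cot b = 2 / Complex.sin (2 * b) := by
  obtain rfl : a = π / 2 - b := by rw [← h]; ring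
  rw [Complex.cot, Complex.cot, Complex.cos_pi_div_two_sub, Complex.sin_pi_div_two_sub,
    Complex.sin_two_mul]
  by_cases hs : Complex.sin b = 0
  · simp [hs]
  by_cases hc : Complex.cos b = 0
  · simp [hc]
  field_simp
  rw [Complex.sin_sq_add_cos_sq]

lemma sq_add_ne_zero {w : ℂ} (hw : 0 < w.re) (a : ℝ) : (a : ℂ) ^ 2 + w ≠ 0 := fun h => by
  have := congrArg Complex.re h
  rw [← Complex.ofReal_pow, Complex.add_re, Complex.ofReal_re, Complex.zero_re] at this
  nlinarith [sq_nonneg a]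

/-- The partial fraction expansion of the hyperbolic secant. -/
lemma hasSum_sech {z : ℂ} (hz : 0 < (z ^ 2).re) :
    HasSum (fun j : ℕ => (4 * (j : ℂ) + 5) / ((4 * (j : ℂ) + 5) ^ 2 + z ^ 2) -
        (4 * (j : ℂ) + 3) / ((4 * (j : ℂ) + 3) ^ 2 + z ^ 2))
      (π / 4 * (Complex.cosh (π / 2 * z))⁻¹ - 1 / (1 + z ^ 2)) := by
  set u : ℂ := z * Complex.I with hu
  have hu2 : z ^ 2 = - u ^ 2 := by rw [hu, mul_pow, Complex.I_sq]; ring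
  have hne (a : ℝ) : (a : ℂ) + u ≠ 0 ∧ (a : ℂ) - u ≠ 0 := by
    rw [← mul_ne_zero_iff]
    convert sq_add_ne_zero hz a using 1
    rw [hu2]; ring
  have h1 : (1 + u) / 4 ∈ Complex.integerComplement := by
    rintro ⟨n, hn⟩
    apply (hne (1 - 4 * n)).1
    push_cast
    linear_combination -4 * hn
  have h2 : (1 - u) / 4 ∈ Complex.integerComplement := by
    rintro ⟨n, hn⟩
    apply (hne (1 - 4 * n)).2
    push_cast
    linear_combination -4 * hn
  have H := ((summable_cotTerm h1).hasSum.add (summable_cotTerm h2).hasSum).mul_left (1 / 8)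
  have c1 := cot_series_rep' h1
  have c2 := cot_series_rep' h2
  unfold cotTerm at H
  rw [← c1, ← c2] at H
  convert H using 1
  · rfl
  · funext j
    have a1 := (hne (4 * j + 5)).1
    have a2 := (hne (4 * j + 5)).2
    have a3 := (hne (4 * j + 3)).1
    have a4 := (hne (4 * j + 3)).2
    push_cast at a1 a2 a3 a4
    have e1 : (4 * (j : ℂ) + 5) ^ 2 + z ^ 2 = (4 * j + 5 + u) * (4 * j + 5 - u) := by
      rw [hu2]; ring
    have e2 : (4 * (j : ℂ) + 3) ^ 2 + z ^ 2 = (4 * j + 3 + u) * (4 * j + 3 - u) := by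
      rw [hu2]; ring
    have e3 : (1 + u) / 4 - ((j : ℂ) + 1) = - (4 * j + 3 - u) / 4 := by ring
    have e4 : (1 + u) / 4 + ((j : ℂ) + 1) = (4 * j + 5 + u) / 4 := by ring
    have e5 : (1 - u) / 4 - ((j : ℂ) + 1) = - (4 * j + 3 + u) / 4 := by ring
    have e6 : (1 - u) / 4 + ((j : ℂ) + 1) = (4 * j + 5 - u) / 4 := by ring
    rw [e1, e2, e3, e4, e5, e6]
    have f1 : (4 * (j : ℂ) + 5) / ((4 * j + 5 + u) * (4 * j + 5 - u)) =
        1 / 2 * (1 / (4 * j + 5 + u) + 1 / (4 * j + 5 - u)) := by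
      field_simp; ring
    have f2 : (4 * (j : ℂ) + 3) / ((4 * j + 3 + u) * (4 * j + 3 - u)) =
        1 / 2 * (1 / (4 * j + 3 + u) + 1 / (4 * j + 3 - u)) := by
      field_simp; ring
    rw [f1, f2]
    simp only [div_eq_mul_inv, neg_mul, mul_inv, inv_neg, inv_inv]
    ring
  · have hc := cot_add_cot (a := π * ((1 + u) / 4)) (b := π * ((1 - u) / 4)) (by ring)
    rw [show 2 * (π * ((1 - u) / 4)) = π / 2 - (π / 2 * z) * Complex.I by rw [hu]; ring,
      Complex.sin_pi_div_two_sub, Complex.cos_mul_I] at hc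
    have a1 := (hne 1).1
    have a2 := (hne 1).2
    push_cast at a1 a2
    have e1 : 1 + z ^ 2 = (1 + u) * (1 - u) := by rw [hu2]; ring
    have e2 : 1 / (1 + z ^ 2) = 1 / 8 * (1 / ((1 + u) / 4) + 1 / ((1 - u) / 4)) := by
      rw [e1]; field_simp; ring
    rw [e2]
    linear_combination (-π / 8 : ℂ) * hc
lemma A_sq_sub_B_sq (b c : ℝ) : A b c ^ 2 - B b c ^ 2 = b ^ 2 := by
  have h : b ^ 2 ≤ √(b ^ 4 + c ^ 2) := Real.le_sqrt_of_sq_le (by nlinarith [sq_nonneg c])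
  rw [A, B, Real.sq_sqrt (by positivity), Real.sq_sqrt (by linarith)]
  ring

lemma two_mul_A_mul_B (b : ℝ) {c : ℝ} (hc : 0 ≤ c) : 2 * (A b c * B b c) = c := by
  rw [A, B, ← Real.sqrt_mul (by positivity)]
  rw [show (√(b ^ 4 + c ^ 2) + b ^ 2) / 2 * ((√(b ^ 4 + c ^ 2) - b ^ 2) / 2) = (c / 2) ^ 2 by
    have := Real.sq_sqrt (by positivity : 0 ≤ b ^ 4 + c ^ 2)
    linear_combination this / 4, Real.sqrt_sq (by linarith)]
  ring

lemma A_add_B_mul_I_sq (b : ℝ) {c : ℝ} (hc : 0 ≤ c) :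
    ((A b c : ℂ) + B b c * Complex.I) ^ 2 = (b : ℂ) ^ 2 + c * Complex.I := by
  have h1 : (A b c : ℂ) ^ 2 - (B b c : ℂ) ^ 2 = (b : ℂ) ^ 2 := mod_cast A_sq_sub_B_sq b c
  have h2 : 2 * ((A b c : ℂ) * B b c) = c := mod_cast two_mul_A_mul_B b hc
  linear_combination h1 + Complex.I * h2 + (B b c : ℂ) ^ 2 * Complex.I_sq

lemma inv_cosh_re (a b : ℝ) : ((Complex.cosh (a + b * Complex.I))⁻¹).re =
    Real.cosh a * Real.cos b / (Real.cosh a ^ 2 - Real.sin b ^ 2) := by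
  have hre : (Complex.cosh (a + b * Complex.I)) =
      (Real.cosh a * Real.cos b : ℝ) + (Real.sinh a * Real.sin b : ℝ) * Complex.I := by
    rw [Complex.cosh_add, Complex.cosh_mul_I, Complex.sinh_mul_I]
    push_cast
    ring
  have hre1 : (Complex.cosh (a + b * Complex.I)).re = Real.cosh a * Real.cos b := by
    rw [hre]; simp [-Complex.ofReal_mul]
  have him1 : (Complex.cosh (a + b * Complex.I)).im = Real.sinh a * Real.sin b := by
    rw [hre]; simp [-Complex.ofReal_mul]
  rw [Complex.inv_re, Complex.normSq_apply, hre1, him1]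
  congr 1
  have h1 := Real.cosh_sq a
  have h2 := Real.sin_sq_add_cos_sq b
  linear_combination (Real.cosh a) ^ 2 * h2 - Real.sin b ^ 2 * h1

lemma chi_even (k : ℕ) : chi (2 * k) = 0 := by simp [chi]

lemma chi_odd (k : ℕ) : chi (2 * k + 1) = (-1) ^ k := by
  have h : ¬ (2 * k + 1) % 2 = 0 := by omega
  rw [chi, if_neg h]
  rcases Nat.even_or_odd k with hk | hk
  · rw [hk.neg_one_pow, if_pos]
    obtain ⟨m, rfl⟩ := hk
    omega
  · rw [hk.neg_one_pow, if_neg]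
    obtain ⟨m, rfl⟩ := hk
    omega

lemma tsum_chi_mul (f : ℕ → ℝ) :
    ∑' n : ℕ, chi (n + 1) * f n = ∑' k : ℕ, (-1) ^ k * f (2 * k) := by
  have hinj : Function.Injective (fun k : ℕ => 2 * k) := fun a b h => by simpa using h
  rw [← hinj.tsum_eq]
  · simp only [chi_odd]
  · intro n hn
    rcases Nat.even_or_odd' n with ⟨m, rfl | rfl⟩
    · exact ⟨m, rfl⟩
    · exact absurd (by simp [show 2 * m + 1 + 1 = 2 * (m + 1) by ring, chi_even]) hn
/-- The cube of the eta function, `η(i · 4 x / π)³`, in terms of `exp (-x)`. -/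
noncomputable def etaCube (x : ℝ) : ℝ :=
  rexp (-x) * (∏' n : ℕ, (1 - (rexp (-x) ^ 8) ^ (n + 1))) ^ 3

lemma dedekindEtaI_pow_three (x : ℝ) : dedekindEtaI (4 * x / π) ^ 3 = etaCube x := by
  have hpi := Real.pi_ne_zero
  have h (n : ℕ) : rexp (-(2 * π * (4 * x / π)) * (n + 1)) = (rexp (-x) ^ 8) ^ (n + 1) := by
    rw [← Real.exp_nat_mul, ← Real.exp_nat_mul]
    congr 1
    push_cast
    field_simp
    ring
  have h' : rexp (-(π * (4 * x / π)) / 12) ^ 3 = rexp (-x) := by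
    rw [← Real.exp_nat_mul]
    congr 1
    push_cast
    field_simp
    ring
  simp only [dedekindEtaI, etaCube, mul_pow, h, h']

lemma etaCube_nonneg {x : ℝ} (hx : 0 < x) : 0 ≤ etaCube x := by
  have h1 : rexp (-x) ^ 8 < 1 := pow_lt_one₀ (by positivity) (by simpa using hx) (by norm_num)
  have := tprod_one_sub_pow_pos (by positivity) h1
  unfold etaCube
  positivity

lemma etaCube_le {x : ℝ} (hx : 0 < x) : etaCube x ≤ rexp (-x) := by
  have h1 : rexp (-x) ^ 8 < 1 := pow_lt_one₀ (by positivity) (by simpa using hx) (by norm_num)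
  have h0 := tprod_one_sub_pow_pos (by positivity) h1
  have hle := tprod_le_partialEuler (by positivity) h1 0
  rw [partialEuler, Finset.prod_range_zero] at hle
  exact mul_le_of_le_one_right (by positivity) (pow_le_one₀ h0.le hle)

lemma hasSum_etaCube {x : ℝ} (hx : 0 < x) :
    HasSum (fun k : ℕ => (-1 : ℝ) ^ k * (2 * (k : ℝ) + 1) * rexp (-(2 * (k : ℝ) + 1) ^ 2 * x))
      (etaCube x) := by
  convert hasSum_jacobi_cube (Real.exp_pos (-x)) (by simpa using hx) using 3 with k
  · rw [← Real.exp_nat_mul]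
    congr 1
    push_cast
    ring
  · rfl

lemma aestronglyMeasurable_etaCube :
    AEStronglyMeasurable etaCube (volume.restrict (Set.Ioi 0)) := by
  refine aestronglyMeasurable_of_tendsto_ae atTop
    (f := fun (N : ℕ) (x : ℝ) => ∑ k ∈ Finset.range N,
      (-1 : ℝ) ^ k * (2 * (k : ℝ) + 1) * rexp (-(2 * (k : ℝ) + 1) ^ 2 * x)) (fun N => ?_) ?_
  · exact Continuous.aestronglyMeasurable (by fun_prop)
  · filter_upwards [self_mem_ae_restrict measurableSet_Ioi] with x hx
    exact (hasSum_etaCube hx).tendsto_sum_nat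

/-- A summable series may be summed in pairs. -/
lemma HasSum.add_pairs {f : ℕ → ℝ} {a : ℝ} (hf : HasSum f a) :
    HasSum (fun j => f (2 * j) + f (2 * j + 1)) a := by
  have h0 := (hf.summable.comp_injective (i := fun j : ℕ => 2 * j)
    (fun a b h => by simpa using h)).hasSum
  have h1 := (hf.summable.comp_injective (i := fun j : ℕ => 2 * j + 1)
    (fun a b h => by simpa using h)).hasSum
  rw [hf.unique (h0.even_add_odd h1)]
  exact h0.add h1

lemma hasSum_etaCube_pairs {x : ℝ} (hx : 0 < x) :
    HasSum (fun j : ℕ => (4 * (j : ℝ) + 5) * rexp (-(4 * (j : ℝ) + 5) ^ 2 * x) -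
      (4 * (j : ℝ) + 3) * rexp (-(4 * (j : ℝ) + 3) ^ 2 * x)) (etaCube x - rexp (-x)) := by
  have h := ((hasSum_nat_add_iff' 1).2 (hasSum_etaCube hx)).add_pairs
  convert h using 1
  · funext j
    push_cast
    simp only [pow_succ, pow_mul]
    norm_num
    ring_nf
  · simp

lemma norm_pair_le {a x : ℝ} (ha : 0 < a) (hx : 0 < x) :
    |(a + 2) * rexp (-(a + 2) ^ 2 * x) - a * rexp (-a ^ 2 * x)| ≤
      2 * rexp (-(a + 2) ^ 2 * x) + a * (rexp (-a ^ 2 * x) - rexp (-(a + 2) ^ 2 * x)) := by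
  have h : rexp (-(a + 2) ^ 2 * x) ≤ rexp (-a ^ 2 * x) :=
    Real.exp_le_exp.2 (mul_le_mul_of_nonneg_right (by nlinarith) hx.le)
  have h0 := Real.exp_pos (-(a + 2) ^ 2 * x)
  have h1 := mul_le_mul_of_nonneg_left h ha.le
  rw [abs_le]
  constructor <;> linarith

lemma integral_exp_neg_mul {w : ℂ} (hw : 0 < w.re) :
    IntegrableOn (fun x : ℝ => Complex.exp (-w * x)) (Set.Ioi 0) ∧
      ∫ x : ℝ in Set.Ioi 0, Complex.exp (-w * x) = 1 / w := by
  have h : (-w).re < 0 := by simpa using hw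
  refine ⟨integrableOn_exp_mul_complex_Ioi h 0, ?_⟩
  rw [integral_exp_mul_complex_Ioi h]
  simp

lemma integral_real_exp_neg_mul {w : ℝ} (hw : 0 < w) :
    IntegrableOn (fun x : ℝ => rexp (-w * x)) (Set.Ioi 0) ∧
      ∫ x : ℝ in Set.Ioi 0, rexp (-w * x) = 1 / w := by
  have h : -w < 0 := by simpa using hw
  refine ⟨integrableOn_exp_mul_Ioi h 0, ?_⟩
  rw [integral_exp_mul_Ioi h]
  simp

lemma norm_cexp_le_one {w : ℂ} (hw : 0 ≤ w.re) {x : ℝ} (hx : 0 ≤ x) :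
    ‖Complex.exp (-w * x)‖ ≤ 1 := by
  rw [Complex.norm_exp, Real.exp_le_one_iff]
  simp
  positivity

lemma integrableOn_etaCube_mul {g : ℝ → ℂ}
    (hg : AEStronglyMeasurable g (volume.restrict (Set.Ioi 0)))
    (hb : ∀ x, 0 < x → ‖g x‖ ≤ 1) :
    IntegrableOn (fun x => (etaCube x : ℂ) * g x) (Set.Ioi 0) := by
  have he := (integral_real_exp_neg_mul one_pos).1
  refine Integrable.mono' he
    ((Complex.continuous_ofReal.comp_aestronglyMeasurable aestronglyMeasurable_etaCube).mul hg) ?_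
  filter_upwards [self_mem_ae_restrict measurableSet_Ioi] with x hx
  rw [norm_mul, Complex.norm_real, Real.norm_of_nonneg (etaCube_nonneg hx), neg_one_mul]
  calc _ ≤ etaCube x * 1 := mul_le_mul_of_nonneg_left (hb x hx) (etaCube_nonneg hx)
    _ ≤ _ := by rw [mul_one]; exact etaCube_le hx

lemma integrableOn_etaCube_mul_cexp {w : ℂ} (hw : 0 ≤ w.re) :
    IntegrableOn (fun x : ℝ => (etaCube x : ℂ) * Complex.exp (-w * x)) (Set.Ioi 0) :=
  integrableOn_etaCube_mul (Continuous.aestronglyMeasurable (by fun_prop))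
    fun _ hx => norm_cexp_le_one hw (le_of_lt hx)

/-- The Laplace transform of `etaCube`. -/
theorem integral_etaCube_mul_cexp {z : ℂ} (hz : 0 < (z ^ 2).re) :
    ∫ x in Set.Ioi (0 : ℝ), (etaCube x : ℂ) * Complex.exp (-z ^ 2 * x) =
      π / 4 * (Complex.cosh (π / 2 * z))⁻¹ := by
  set w := z ^ 2 with hwdef
  have hre (a : ℝ) : 0 < ((a : ℂ) ^ 2 + w).re := by
    rw [← Complex.ofReal_pow, Complex.add_re, Complex.ofReal_re]
    positivity
  let G : ℕ → ℝ → ℂ := fun j x =>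
    ((4 * j + 5 : ℝ) : ℂ) * Complex.exp (-(((4 * j + 5 : ℝ) : ℂ) ^ 2 + w) * x) -
      ((4 * j + 3 : ℝ) : ℂ) * Complex.exp (-(((4 * j + 3 : ℝ) : ℂ) ^ 2 + w) * x)
  have hGeq (j : ℕ) (x : ℝ) : G j x = (((4 * j + 5) * rexp (-(4 * j + 5) ^ 2 * x) -
      (4 * j + 3) * rexp (-(4 * j + 3) ^ 2 * x) : ℝ) : ℂ) * Complex.exp (-w * x) := by
    simp only [G, neg_add, add_mul _ _ (x : ℂ), Complex.exp_add]
    push_cast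
    ring
  have hG_int (j : ℕ) : Integrable (G j) (volume.restrict (Set.Ioi 0)) :=
    ((integral_exp_neg_mul (hre _)).1.const_mul _).sub ((integral_exp_neg_mul (hre _)).1.const_mul _)
  have hG_val (j : ℕ) : ∫ x in Set.Ioi (0 : ℝ), G j x =
      (4 * (j : ℂ) + 5) / ((4 * (j : ℂ) + 5) ^ 2 + w) -
        (4 * (j : ℂ) + 3) / ((4 * (j : ℂ) + 3) ^ 2 + w) := by
    rw [integral_sub ((integral_exp_neg_mul (hre _)).1.const_mul _)
      ((integral_exp_neg_mul (hre _)).1.const_mul _), integral_const_mul, integral_const_mul,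
      (integral_exp_neg_mul (hre _)).2, (integral_exp_neg_mul (hre _)).2, mul_one_div, mul_one_div]
    push_cast
    rfl
  have hG_norm (j : ℕ) : ∫ x in Set.Ioi (0 : ℝ), ‖G j x‖ ≤ 10 * (1 / ((j : ℝ) + 1) ^ 2) := by
    have ha : (0 : ℝ) < 4 * j + 3 := by positivity
    set a : ℝ := 4 * j + 3 with hadef
    have hb : (4 : ℝ) * j + 5 = a + 2 := by rw [hadef]; ring
    have i1 := integral_real_exp_neg_mul (show 0 < (a + 2) ^ 2 by positivity)
    have i2 := integral_real_exp_neg_mul (show 0 < a ^ 2 by positivity)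
    have i3 : IntegrableOn (fun x => rexp (-a ^ 2 * x) - rexp (-(a + 2) ^ 2 * x)) (Set.Ioi 0) :=
      i2.1.sub i1.1
    calc ∫ x in Set.Ioi (0 : ℝ), ‖G j x‖ ≤ ∫ x in Set.Ioi (0 : ℝ), (2 * rexp (-(a + 2) ^ 2 * x) +
          a * (rexp (-a ^ 2 * x) - rexp (-(a + 2) ^ 2 * x))) := by
          refine setIntegral_mono_on (hG_int j).norm
            ((i1.1.const_mul _).add (i3.const_mul _)) measurableSet_Ioi fun x hx => ?_
          rw [hGeq, norm_mul, Complex.norm_real, hb, Real.norm_eq_abs]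
          exact (mul_le_of_le_one_right (abs_nonneg _)
            (norm_cexp_le_one hz.le (le_of_lt hx))).trans (norm_pair_le ha hx)
      _ = 2 * (1 / (a + 2) ^ 2) + a * (1 / a ^ 2 - 1 / (a + 2) ^ 2) := by
          rw [integral_add (i1.1.const_mul _) (i3.const_mul _), integral_const_mul,
            integral_const_mul, integral_sub i2.1 i1.1, i1.2, i2.2]
      _ ≤ 10 * (1 / a ^ 2) := by
          have e : 10 * (1 / a ^ 2) - (2 * (1 / (a + 2) ^ 2) + a * (1 / a ^ 2 - 1 / (a + 2) ^ 2)) =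
              (4 * a ^ 2 + 36 * a + 40) / (a ^ 2 * (a + 2) ^ 2) := by
            field_simp
            ring
          have : 0 ≤ (4 * a ^ 2 + 36 * a + 40) / (a ^ 2 * (a + 2) ^ 2) := by positivity
          linarith
      _ ≤ _ := by
          have : (j : ℝ) + 1 ≤ a := by rw [hadef]; linarith [(Nat.cast_nonneg j : (0 : ℝ) ≤ j)]
          gcongr
  have hG_sum : Summable fun j => ∫ x in Set.Ioi (0 : ℝ), ‖G j x‖ := by
    refine Summable.of_nonneg_of_le (fun j => integral_nonneg fun x => norm_nonneg _) hG_norm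
      (Summable.mul_left _ ?_)
    exact_mod_cast (summable_nat_add_iff 1).2 (Real.summable_one_div_nat_pow.2 one_lt_two)
  have H := hasSum_integral_of_summable_integral_norm hG_int hG_sum
  have hone : 0 < (1 + w).re := by simpa using hre 1
  have hint : ∫ x in Set.Ioi (0 : ℝ), ∑' j, G j x =
      (∫ x in Set.Ioi (0 : ℝ), (etaCube x : ℂ) * Complex.exp (-w * x)) - 1 / (1 + w) := by
    rw [← (integral_exp_neg_mul hone).2,
      ← integral_sub (integrableOn_etaCube_mul_cexp hz.le) (integral_exp_neg_mul hone).1]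
    refine setIntegral_congr_fun measurableSet_Ioi fun x hx => ?_
    simp only [hGeq]
    rw [((Complex.hasSum_ofReal.2 (hasSum_etaCube_pairs hx)).mul_right _).tsum_eq, neg_add, add_mul,
      Complex.exp_add]
    push_cast
    ring_nf
  rw [hint] at H
  simp only [hG_val] at H
  exact sub_left_inj.1 (H.unique (hasSum_sech hz))

lemma cosh_inv_le (x : ℝ) : (Real.cosh x)⁻¹ ≤ 2 * rexp (-x) := by
  rw [inv_le_iff_one_le_mul₀ (Real.cosh_pos x), Real.cosh_eq]
  have h : rexp (-x) * rexp x = 1 := by rw [← Real.exp_add]; simp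
  nlinarith [Real.exp_pos (-x)]

lemma integral_etaCube_mul_exp {n : ℝ} (hn : 0 < n) :
    ∫ x in Set.Ioi (0 : ℝ), etaCube x * rexp (-n ^ 2 * x) = π / 4 * (Real.cosh (π / 2 * n))⁻¹ := by
  have hz : 0 < ((n : ℂ) ^ 2).re := by
    rw [← Complex.ofReal_pow, Complex.ofReal_re]
    positivity
  have h := integral_etaCube_mul_cexp hz
  apply Complex.ofReal_injective
  rw [← integral_complex_ofReal]
  push_cast
  exact h

lemma summable_odd_mul_sech :
    Summable fun k : ℕ => (2 * (k : ℝ) + 1) * (π / 4 * (Real.cosh (π / 2 * (2 * k + 1)))⁻¹) := by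
  have hr : ‖rexp (-1)‖ < 1 := by
    rw [Real.norm_of_nonneg (Real.exp_pos _).le]
    rw [Real.exp_lt_one_iff]
    norm_num
  have h : Summable fun k : ℕ => ((k : ℝ) + 1) * rexp (-1) ^ (k + 1) := by
    have h' : Summable fun k : ℕ => (k : ℝ) ^ 1 * rexp (-1) ^ k :=
      summable_pow_mul_geometric_of_norm_lt_one 1 hr
    simpa [Function.comp_def] using h'.comp_injective (add_left_injective 1)
  refine Summable.of_nonneg_of_le (fun k => ?_) (fun k => ?_) (h.mul_left (2 * (π / 4 * 2)))
  · have := Real.cosh_pos (π / 2 * (2 * k + 1))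
    positivity
  · have hc := cosh_inv_le (π / 2 * (2 * k + 1))
    have he : rexp (-(π / 2 * (2 * k + 1))) ≤ rexp (-1) ^ (k + 1) := by
      rw [← Real.exp_nat_mul, Real.exp_le_exp]
      push_cast
      nlinarith [Real.two_le_pi, (Nat.cast_nonneg k : (0 : ℝ) ≤ k)]
    calc (2 * (k : ℝ) + 1) * (π / 4 * (Real.cosh (π / 2 * (2 * k + 1)))⁻¹)
        ≤ (2 * ((k : ℝ) + 1)) * (π / 4 * (2 * rexp (-1) ^ (k + 1))) := by
          gcongr
          · linarith
          · exact hc.trans (by gcongr)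
      _ = 2 * (π / 4 * 2) * (((k : ℝ) + 1) * rexp (-1) ^ (k + 1)) := by ring

/-- The Fourier–Laplace transform of the square of `etaCube`. -/
theorem hasSum_integral_etaCube_sq {c : ℝ} (hc : 0 ≤ c) :
    HasSum (fun k : ℕ => (-1 : ℂ) ^ k * (2 * (k : ℂ) + 1) * (π / 4 *
        (Complex.cosh (π / 2 * (A (2 * k + 1) c + B (2 * k + 1) c * Complex.I)))⁻¹))
      (∫ x in Set.Ioi (0 : ℝ),
        (etaCube x : ℂ) * ((etaCube x : ℂ) * Complex.exp (-(c * Complex.I) * x))) := by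
  let F : ℕ → ℝ → ℂ := fun k x => ((-1 : ℂ) ^ k * (2 * (k : ℂ) + 1)) *
    ((etaCube x : ℂ) * Complex.exp (-(((2 * k + 1 : ℝ) : ℂ) ^ 2 + c * Complex.I) * x))
  have hre (k : ℕ) : 0 < (((2 * k + 1 : ℝ) : ℂ) ^ 2 + c * Complex.I).re := by
    rw [← Complex.ofReal_pow, Complex.add_re, Complex.ofReal_re, Complex.re_ofReal_mul,
      Complex.I_re, mul_zero, add_zero]
    positivity
  have hF_int (k : ℕ) : Integrable (F k) (volume.restrict (Set.Ioi 0)) :=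
    (integrableOn_etaCube_mul_cexp (hre k).le).const_mul _
  have hF_norm (k : ℕ) : ∫ x in Set.Ioi (0 : ℝ), ‖F k x‖ =
      (2 * (k : ℝ) + 1) * (π / 4 * (Real.cosh (π / 2 * (2 * k + 1)))⁻¹) := by
    rw [← integral_etaCube_mul_exp (by positivity), ← integral_const_mul]
    refine setIntegral_congr_fun measurableSet_Ioi fun x hx => ?_
    have h1 : ‖(2 * (k : ℂ) + 1)‖ = 2 * (k : ℝ) + 1 := by
      rw [← Real.norm_of_nonneg (by positivity : 0 ≤ 2 * (k : ℝ) + 1), ← Complex.norm_real]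
      push_cast
      rfl
    have h2 : ((((2 * k + 1 : ℝ) : ℂ) ^ 2 + c * Complex.I) * x).re = (2 * k + 1 : ℝ) ^ 2 * x := by
      rw [← Complex.ofReal_pow, Complex.re_mul_ofReal, Complex.add_re, Complex.ofReal_re,
        Complex.re_ofReal_mul, Complex.I_re, mul_zero, add_zero]
    simp only [F]
    rw [norm_mul, norm_mul, norm_mul, norm_pow, norm_neg, norm_one, one_pow, one_mul, h1,
      Complex.norm_real, Real.norm_of_nonneg (etaCube_nonneg hx), Complex.norm_exp, neg_mul,
      Complex.neg_re, h2, neg_mul]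
  have H := hasSum_integral_of_summable_integral_norm hF_int (by
    simp only [hF_norm]
    exact summable_odd_mul_sech)
  convert H using 1
  · rfl
  · funext k
    have hsq := A_add_B_mul_I_sq (2 * k + 1) hc
    simp only [F]
    rw [integral_const_mul, ← hsq, integral_etaCube_mul_cexp (by rw [hsq]; exact hre k)]
  · refine setIntegral_congr_fun measurableSet_Ioi fun x hx => ?_
    have h := ((Complex.hasSum_ofReal.2 (hasSum_etaCube hx)).mul_right
      ((etaCube x : ℂ) * Complex.exp (-(c * Complex.I) * x))).tsum_eq
    simp only [F]
    rw [← h]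
    refine tsum_congr fun k => ?_
    rw [neg_add, add_mul, Complex.exp_add]
    push_cast
    ring

theorem eta6_cos (c : ℝ) (hc : 0 < c) :
    ∫ x in Set.Ioi (0 : ℝ), (dedekindEtaI (4 * x / π)) ^ 6 * Real.cos (c * x)
      = (π / 4) *
          ∑' n : ℕ, chi (n + 1) * ((n : ℝ) + 1) *
            ((Real.cosh (π / 2 * A ((n : ℝ) + 1) c) * Real.cos (π / 2 * B ((n : ℝ) + 1) c)) /
              ((Real.cosh (π / 2 * A ((n : ℝ) + 1) c)) ^ 2 -
                (Real.sin (π / 2 * B ((n : ℝ) + 1) c)) ^ 2)) := by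
  have H := Complex.hasSum_re (hasSum_integral_etaCube_sq hc.le)
  have hint : IntegrableOn (fun x : ℝ => (etaCube x : ℂ) *
      ((etaCube x : ℂ) * Complex.exp (-(c * Complex.I) * x))) (Set.Ioi 0) := by
    have hI : 0 ≤ ((c : ℂ) * Complex.I).re := by simp
    refine integrableOn_etaCube_mul (integrableOn_etaCube_mul_cexp hI).1 fun x hx => ?_
    rw [norm_mul, Complex.norm_real, Real.norm_of_nonneg (etaCube_nonneg hx)]
    exact mul_le_one₀ ((etaCube_le hx).trans (by simpa using hx.le)) (norm_nonneg _)
      (norm_cexp_le_one hI hx.le)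
  have hre : (∫ x in Set.Ioi (0 : ℝ), (etaCube x : ℂ) *
      ((etaCube x : ℂ) * Complex.exp (-(c * Complex.I) * x))).re =
      ∫ x in Set.Ioi (0 : ℝ), dedekindEtaI (4 * x / π) ^ 6 * Real.cos (c * x) := by
    rw [← RCLike.re_to_complex, ← integral_re hint]
    refine setIntegral_congr_fun measurableSet_Ioi fun x _ => ?_
    have he : Complex.exp (-(c * Complex.I) * x) = Complex.exp (((-(c * x) : ℝ) : ℂ) * Complex.I) := by
      congr 1
      push_cast
      ring
    simp only [RCLike.re_to_complex]
    rw [Complex.re_ofReal_mul, Complex.re_ofReal_mul, he, Complex.exp_ofReal_mul_I_re, Real.cos_neg,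
      ← dedekindEtaI_pow_three]
    ring
  rw [hre] at H
  simp only [mul_assoc (chi _)]
  rw [tsum_chi_mul (fun n => ((n : ℝ) + 1) *
            ((Real.cosh (π / 2 * A ((n : ℝ) + 1) c) * Real.cos (π / 2 * B ((n : ℝ) + 1) c)) /
              ((Real.cosh (π / 2 * A ((n : ℝ) + 1) c)) ^ 2 -
                (Real.sin (π / 2 * B ((n : ℝ) + 1) c)) ^ 2))), ← H.tsum_eq, ← tsum_mul_left]
  refine tsum_congr fun k => ?_
  have hz : (π : ℂ) / 2 * (A (2 * k + 1) c + B (2 * k + 1) c * Complex.I) =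
      ((π / 2 * A (2 * k + 1) c : ℝ) : ℂ) + ((π / 2 * B (2 * k + 1) c : ℝ) : ℂ) * Complex.I := by
    push_cast
    ring
  have hk : (-1 : ℂ) ^ k * (2 * (k : ℂ) + 1) * (π / 4 *
        (Complex.cosh (π / 2 * (A (2 * k + 1) c + B (2 * k + 1) c * Complex.I)))⁻¹) =
      (((-1) ^ k * (2 * (k : ℝ) + 1) * (π / 4) : ℝ) : ℂ) *
        (Complex.cosh (π / 2 * (A (2 * k + 1) c + B (2 * k + 1) c * Complex.I)))⁻¹ := by
    push_cast
    ring
  rw [hk, Complex.re_ofReal_mul, hz, inv_cosh_re]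
  push_cast
  ring
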